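/- arXiv:1606.08129 — 4 statements merged into one kernel-verified Lean document; each statement's English description precedes it below -/
import Mathlib

section
/- For every ω ∈ (0,1) there exists a constant C > 0 such that for every real Y ≠ 0, ∫_{−1}^{0} ((X+1)² + Y²)^{(ω−1)/2} · (X² + Y²)^{(ω−1)/2} dX ≤ C · (max(1, |Y|))^{2(ω−1)}. -/
theorem rpow_half_le_rpow_of_sq_le {s t a : ℝ} (hs : s ≤ 0) (ht : 0 < t) (h : t ^ 2 ≤ a) :
    a ^ (s / 2) ≤ t ^ s := by
  calc a ^ (s / 2) ≤ (t ^ 2) ^ (s / 2) :=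
        Real.rpow_le_rpow_of_nonpos (by positivity) h (by linarith)
    _ = t ^ s := by
        rw [← Real.rpow_natCast, ← Real.rpow_mul ht.le]
        congr 1
        push_cast
        ring

theorem rpow_mul_rpow_le_of_mem_Ioo {s X : ℝ} (Y : ℝ) (hs : s ≤ 0)
    (hX : X ∈ Set.Ioo (-1 : ℝ) 0) :
    ((X + 1) ^ 2 + Y ^ 2) ^ (s / 2) * (X ^ 2 + Y ^ 2) ^ (s / 2)
      ≤ (1 / 2 : ℝ) ^ s * ((0 - X) ^ s + (X + 1) ^ s) := by
  obtain ⟨h₁, h₂⟩ := hX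
  have hu : 0 < X + 1 := by linarith
  have hv : 0 < 0 - X := by linarith
  have hA : ((X + 1) ^ 2 + Y ^ 2) ^ (s / 2) ≤ (X + 1) ^ s :=
    rpow_half_le_rpow_of_sq_le hs hu (by nlinarith)
  have hB : (X ^ 2 + Y ^ 2) ^ (s / 2) ≤ (0 - X) ^ s :=
    rpow_half_le_rpow_of_sq_le hs hv (by nlinarith)
  have hc : (0 : ℝ) < (1 / 2 : ℝ) ^ s := by positivity
  have hu' : 0 < (X + 1) ^ s := by positivity
  have hv' : 0 < (0 - X) ^ s := by positivity
  refine (mul_le_mul hA hB (by positivity) hu'.le).trans ?_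
  rcases le_total (1 / 2) (X + 1) with h | h
  · have := Real.rpow_le_rpow_of_nonpos (by norm_num) h hs
    nlinarith
  · have := Real.rpow_le_rpow_of_nonpos (by norm_num) (show 1 / 2 ≤ 0 - X by linarith) hs
    nlinarith

/-- Uniform bound on the rescaled inner integral in the estimate of I₁ (Lemma 4.1). -/
theorem stmt_3 (ω : ℝ) (hω : ω ∈ Set.Ioo (0 : ℝ) 1) :
    ∃ C > 0, ∀ Y : ℝ, Y ≠ 0 →
      (∫ X in (-1 : ℝ)..0, ((X + 1) ^ 2 + Y ^ 2) ^ ((ω - 1) / 2) * (X ^ 2 + Y ^ 2) ^ ((ω - 1) / 2))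
        ≤ C * (max 1 |Y|) ^ (2 * (ω - 1)) := by
  obtain ⟨h₀, h₁⟩ := hω
  have hs : ω - 1 ≤ 0 := by linarith
  set g : ℝ → ℝ := fun X ↦ (1 / 2 : ℝ) ^ (ω - 1) * ((0 - X) ^ (ω - 1) + (X + 1) ^ (ω - 1))
  have hpow (a b : ℝ) : IntervalIntegrable (fun x : ℝ ↦ x ^ (ω - 1)) MeasureTheory.volume a b :=
    intervalIntegral.intervalIntegrable_rpow' (by linarith)
  have hgi : IntervalIntegrable g MeasureTheory.volume (-1) 0 := by
    refine IntervalIntegrable.const_mul (IntervalIntegrable.add ?_ ?_) _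
    · simpa using (hpow 1 0).comp_sub_left 0
    · simpa using (hpow 0 1).comp_add_right 1
  have hg0 : 0 ≤ ∫ X in (-1 : ℝ)..0, g X := by
    refine intervalIntegral.integral_nonneg (by norm_num) fun X hX ↦ ?_
    have hu : 0 ≤ X + 1 := by linarith [hX.1]
    have hv : 0 ≤ 0 - X := by linarith [hX.2]
    positivity
  refine ⟨1 + ∫ X in (-1 : ℝ)..0, g X, by linarith, fun Y hY ↦ ?_⟩
  have hY2 : 0 < Y ^ 2 := by positivity
  have hfi : IntervalIntegrable
      (fun X : ℝ ↦ ((X + 1) ^ 2 + Y ^ 2) ^ ((ω - 1) / 2) * (X ^ 2 + Y ^ 2) ^ ((ω - 1) / 2))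
      MeasureTheory.volume (-1) 0 := by
    refine Continuous.intervalIntegrable (Continuous.mul ?_ ?_) _ _
    · exact Continuous.rpow_const (by fun_prop) fun X ↦ Or.inl (by positivity)
    · exact Continuous.rpow_const (by fun_prop) fun X ↦ Or.inl (by positivity)
  rcases le_total |Y| 1 with h | h
  · rw [max_eq_left h, Real.one_rpow, mul_one]
    have := intervalIntegral.integral_mono_on_of_le_Ioo (by norm_num) hfi hgi
      fun X hX ↦ rpow_mul_rpow_le_of_mem_Ioo Y hs hX
    linarith
  · rw [max_eq_right h]
    have hYpos : 0 < |Y| := abs_pos.mpr hY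
    have hbd (u : ℝ) : (u ^ 2 + Y ^ 2) ^ ((ω - 1) / 2) ≤ |Y| ^ (ω - 1) :=
      rpow_half_le_rpow_of_sq_le hs hYpos (by rw [sq_abs]; nlinarith)
    have hle := intervalIntegral.integral_mono_on_of_le_Ioo (μ := MeasureTheory.volume)
      (a := -1) (b := 0) (g := fun _ ↦ |Y| ^ (2 * (ω - 1)))
      (by norm_num) hfi intervalIntegrable_const fun X _ ↦ by
        rw [two_mul, Real.rpow_add hYpos]
        exact mul_le_mul (hbd _) (hbd _) (by positivity) (by positivity)
    rw [intervalIntegral.integral_const] at hle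
    have hP : 0 ≤ |Y| ^ (2 * (ω - 1)) := by positivity
    norm_num at hle
    nlinarith [mul_nonneg hg0 hP]
end

section
/- For every ω ∈ (1/2, 1) there exists a constant C > 0 such that for all real t, δ with 0 < t ≤ δ, ∫_{−δ}^{0} ∫_{−t}^{0} ((x+t)² + y²)^{(ω−1)/2} · (x² + y²)^{(ω−1)/2} dx dy ≤ C · t · δ^{2ω−1}. -/
theorem rpow_add_sq_le_rpow {p a y : ℝ} (hp : p ≤ 0) (hy : 0 < y) :
    (a ^ 2 + y ^ 2) ^ (p / 2) ≤ y ^ p := by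
  calc (a ^ 2 + y ^ 2) ^ (p / 2) ≤ (y ^ 2) ^ (p / 2) :=
        Real.rpow_le_rpow_of_nonpos (by positivity) (by nlinarith [sq_nonneg a]) (by linarith)
    _ = y ^ p := by
        rw [← Real.rpow_natCast, ← Real.rpow_mul hy.le]
        congr 1
        push_cast
        ring

/-- Estimate of the term I₁ in the proof of Lemma 4.1. -/
theorem stmt_4 (ω : ℝ) (hω : ω ∈ Set.Ioo (1 / 2 : ℝ) 1) :
    ∃ C > 0, ∀ t δ : ℝ, 0 < t → t ≤ δ →
      (∫ y in (-δ)..0, ∫ x in (-t)..0,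
          ((x + t) ^ 2 + y ^ 2) ^ ((ω - 1) / 2) * (x ^ 2 + y ^ 2) ^ ((ω - 1) / 2))
        ≤ C * t * δ ^ (2 * ω - 1) := by
  obtain ⟨h1, h2⟩ := hω
  have hpos : 0 < 2 * ω - 1 := by linarith
  refine ⟨1 / (2 * ω - 1), by positivity, fun t δ ht htδ => ?_⟩
  have hδ : 0 < δ := ht.trans_le htδ
  set F : ℝ → ℝ := fun y => ∫ x in (-t)..0,
    ((x + t) ^ 2 + y ^ 2) ^ ((ω - 1) / 2) * (x ^ 2 + y ^ 2) ^ ((ω - 1) / 2) with hF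
  have hreflect : ∫ y in (-δ)..0, F y = ∫ y in (0 : ℝ)..δ, F y := by
    have h := intervalIntegral.integral_comp_neg (a := 0) (b := δ) F
    rw [neg_zero] at h
    rw [← h]
    simp only [hF, neg_sq]
  have hbound : ∀ y ∈ Set.Ioc 0 δ, ‖F y‖ ≤ y ^ (2 * ω - 2) * t := by
    intro y hy
    have h := intervalIntegral.norm_integral_le_of_norm_le_const (a := -t) (b := 0)
      (C := y ^ (2 * ω - 2)) (f := fun x : ℝ =>
        ((x + t) ^ 2 + y ^ 2) ^ ((ω - 1) / 2) * (x ^ 2 + y ^ 2) ^ ((ω - 1) / 2)) (by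
      intro x _
      rw [Real.norm_of_nonneg (by positivity),
        show 2 * ω - 2 = (ω - 1) + (ω - 1) by ring, Real.rpow_add hy.1]
      have hω1 : ω - 1 ≤ 0 := by linarith
      exact mul_le_mul (rpow_add_sq_le_rpow hω1 hy.1) (rpow_add_sq_le_rpow hω1 hy.1)
        (by positivity) (Real.rpow_nonneg hy.1.le _))
    simpa [abs_of_pos ht] using h
  have hint : IntervalIntegrable (fun y : ℝ => y ^ (2 * ω - 2) * t) MeasureTheory.volume 0 δ :=
    (intervalIntegral.intervalIntegrable_rpow' (by linarith)).mul_const t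
  calc ∫ y in (-δ)..0, F y = ∫ y in (0 : ℝ)..δ, F y := hreflect
    _ ≤ ‖∫ y in (0 : ℝ)..δ, F y‖ := Real.le_norm_self _
    _ ≤ ∫ y in (0 : ℝ)..δ, y ^ (2 * ω - 2) * t :=
        intervalIntegral.norm_integral_le_of_norm_le hδ.le
          (Filter.Eventually.of_forall hbound) hint
    _ = 1 / (2 * ω - 1) * t * δ ^ (2 * ω - 1) := by
        rw [intervalIntegral.integral_mul_const, integral_rpow (Or.inl (by linarith)),
          show 2 * ω - 2 + 1 = 2 * ω - 1 by ring, Real.zero_rpow hpos.ne']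
        ring
end

section
/- Let P₁, P₂, P₃, V₁, V₂, V₃ ∈ ℝ², and for t ∈ ℝ let T_t denote the convex hull of {P₁ + tV₁, P₂ + tV₂, P₃ + tV₃}. Then there exists a constant C > 0 such that for every t ∈ [0,1], the volume (two-dimensional Lebesgue measure) of the symmetric difference T₀ Δ T_t is at most C·t. -/
open MeasureTheory

section ConvexSweep

open Metric
open scoped Pointwise

variable {E : Type*} [NormedAddCommGroup E] [NormedSpace ℝ E]

theorem isCompact_segment_zero (v : E) : IsCompact (segment ℝ 0 v) := by
  rw [segment_eq_image ℝ 0 v]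
  exact isCompact_Icc.image (by fun_prop)

theorem norm_le_of_mem_segment_zero {v y : E} (hy : y ∈ segment ℝ 0 v) : ‖y‖ ≤ ‖v‖ := by
  have h : segment ℝ 0 v ⊆ closedBall 0 ‖v‖ :=
    (convex_closedBall (0 : E) ‖v‖).segment_subset (by simp) (by simp)
  simpa using h hy

theorem subset_add_segment_zero (K : Set E) (v : E) : K ⊆ K + segment ℝ 0 v :=
  Set.subset_add_left K (left_mem_segment ℝ 0 v)

theorem add_segment_zero_subset_closedBall {K : Set E} {R M : ℝ} {v : E}
    (hK : K ⊆ closedBall 0 R) (hv : ‖v‖ ≤ M) :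
    K + segment ℝ 0 v ⊆ closedBall 0 (R + M) := by
  rintro _ ⟨k, hk, y, hy, rfl⟩
  have h₁ : ‖k‖ ≤ R := by simpa using hK hk
  have h₂ := norm_le_of_mem_segment_zero hy
  simpa using (norm_add_le k y).trans (by linarith)

/-- Sweeping a convex set along `v` adds a region that is disjoint from its translates by
positive multiples of `v`. -/
theorem Convex.add_notMem_sweep_diff {K : Set E} (hK : Convex ℝ K) {v y : E} {a : ℝ}
    (ha : 1 ≤ a) (hy : y ∈ (K + segment ℝ 0 v) \ K) :
    y + a • v ∉ (K + segment ℝ 0 v) \ K := by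
  rintro ⟨⟨k, hk, z, hz, hkz⟩, -⟩
  obtain ⟨⟨k', hk', z', hz', hkz'⟩, hyK⟩ := hy
  rw [segment_eq_image ℝ 0 v] at hz hz'
  obtain ⟨s, ⟨hs0, hs1⟩, rfl⟩ := hz
  obtain ⟨s', ⟨hs0', hs1'⟩, rfl⟩ := hz'
  simp only [smul_zero, zero_add] at hkz hkz'
  have hk_eq : k = y + (a - s) • v := by
    rw [sub_smul, ← add_sub_assoc, ← hkz]; abel
  have hk'_eq : k' = y - s' • v := by rw [← hkz']; abel
  rcases eq_or_lt_of_le hs0' with h | h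
  · apply hyK
    rw [← hkz', ← h]
    simpa using hk'
  · apply hyK
    have hd : 0 < a - s + s' := by linarith
    have hmem := hK hk' hk (a := (a - s) / (a - s + s')) (b := s' / (a - s + s'))
      (div_nonneg (by linarith) hd.le) (by positivity) (by field_simp)
    convert hmem using 1
    rw [hk_eq, hk'_eq]
    match_scalars <;> field_simp
    ring

variable [MeasurableSpace E] [BorelSpace E] (μ : Measure E) [μ.IsAddHaarMeasure]

theorem Convex.nat_mul_measure_sweep_diff_le {K : Set E} (hK : Convex ℝ K) (hKc : IsCompact K)
    {R : ℝ} (hR : K ⊆ closedBall 0 R) (v : E) (n : ℕ) :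
    n * μ ((K + segment ℝ 0 v) \ K) ≤ μ (closedBall 0 (R + n * ‖v‖)) := by
  set D := (K + segment ℝ 0 v) \ K
  have hDm : MeasurableSet D :=
    (hKc.add (isCompact_segment_zero v)).measurableSet.diff hKc.measurableSet
  let A : ℕ → Set E := fun k => (fun x => x + (-((k : ℝ) • v))) ⁻¹' D
  have hAm (k : ℕ) : MeasurableSet (A k) := (measurable_add_const _) hDm
  have hAμ (k : ℕ) : μ (A k) = μ D := measure_preimage_add_right μ _ D
  have hlt {i j : ℕ} (hij : i < j) : Disjoint (A i) (A j) := by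
    rw [Set.disjoint_left]
    intro x hi hj
    have h1 : (1 : ℝ) ≤ (j : ℝ) - i := by
      have : (i : ℝ) + 1 ≤ j := by exact_mod_cast hij
      linarith
    apply hK.add_notMem_sweep_diff h1 hj
    have hx : x + (-((j : ℝ) • v)) + ((j : ℝ) - i) • v = x + (-((i : ℝ) • v)) := by module
    rw [hx]
    exact hi
  have hdisj : Pairwise (Function.onFun Disjoint A) := fun i j hij =>
    (lt_or_gt_of_ne hij).elim hlt fun h => (hlt h).symm
  calc n * μ D = ∑ k ∈ Finset.range n, μ (A k) := by simp [hAμ]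
    _ = μ (⋃ k ∈ Finset.range n, A k) :=
      (measure_biUnion_finset (fun i _ j _ hij => hdisj hij) fun k _ => hAm k).symm
    _ ≤ μ (closedBall 0 (R + n * ‖v‖)) := by
      refine measure_mono (Set.iUnion₂_subset fun k hk x hx => ?_)
      have h1 : ‖x + (-((k : ℝ) • v))‖ ≤ R + ‖v‖ := by
        simpa using add_segment_zero_subset_closedBall hR le_rfl hx.1
      have h2 : ‖(k : ℝ) • v‖ = k * ‖v‖ := by simp [norm_smul]
      have h3 : ((k : ℝ) + 1) * ‖v‖ ≤ n * ‖v‖ := by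
        have : (k : ℝ) + 1 ≤ n := by exact_mod_cast Finset.mem_range.1 hk
        gcongr
      have h4 := norm_add_le (x + (-((k : ℝ) • v))) ((k : ℝ) • v)
      rw [neg_add_cancel_right] at h4
      simp only [mem_closedBall, dist_zero_right]
      linarith

theorem Convex.measure_sweep_diff_le {K : Set E} (hK : Convex ℝ K) (hKc : IsCompact K)
    {R M t : ℝ} (hR : K ⊆ closedBall 0 R) {w : E} (hw : ‖w‖ ≤ M) (ht₀ : 0 < t) (ht₁ : t ≤ 1) :
    μ ((K + segment ℝ 0 (t • w)) \ K) ≤ ENNReal.ofReal t * μ (closedBall 0 (R + 2 * M)) := by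
  set n := ⌈1 / t⌉₊
  have hn : 1 ≤ t * n := by
    have := mul_le_mul_of_nonneg_left (Nat.le_ceil (1 / t)) ht₀.le
    rwa [mul_one_div_cancel ht₀.ne'] at this
  have hn' : n * t ≤ 2 := by
    have := mul_le_mul_of_nonneg_right (Nat.ceil_lt_add_one (one_div_pos.2 ht₀).le).le ht₀.le
    rw [add_mul, one_div_mul_cancel ht₀.ne'] at this
    linarith
  have hball : R + n * ‖t • w‖ ≤ R + 2 * M := by
    rw [norm_smul, Real.norm_of_nonneg ht₀.le, ← mul_assoc]
    gcongr
  calc μ ((K + segment ℝ 0 (t • w)) \ K)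
      ≤ ENNReal.ofReal (t * n) * μ ((K + segment ℝ 0 (t • w)) \ K) :=
        le_mul_of_one_le_left zero_le (ENNReal.one_le_ofReal.2 hn)
    _ = ENNReal.ofReal t * (n * μ ((K + segment ℝ 0 (t • w)) \ K)) := by
        rw [ENNReal.ofReal_mul ht₀.le, ENNReal.ofReal_natCast, mul_assoc]
    _ ≤ ENNReal.ofReal t * μ (closedBall 0 (R + 2 * M)) := by
        gcongr
        exact (hK.nat_mul_measure_sweep_diff_le μ hKc hR _ n).trans
          (measure_mono (closedBall_subset_closedBall hball))

theorem measure_convexHull_triple_diff_le {Q₁ Q₂ Q₃ W₁ W₂ W₃ : E} {R M t : ℝ}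
    (hQ₁ : ‖Q₁‖ ≤ R) (hQ₂ : ‖Q₂‖ ≤ R) (hQ₃ : ‖Q₃‖ ≤ R)
    (hW₁ : ‖W₁‖ ≤ M) (hW₂ : ‖W₂‖ ≤ M) (hW₃ : ‖W₃‖ ≤ M) (ht₀ : 0 < t) (ht₁ : t ≤ 1) :
    μ (convexHull ℝ {Q₁ + t • W₁, Q₂ + t • W₂, Q₃ + t • W₃} \ convexHull ℝ {Q₁, Q₂, Q₃}) ≤
      3 * (ENNReal.ofReal t * μ (closedBall 0 (R + 4 * M))) := by
  have hM : 0 ≤ M := (norm_nonneg _).trans hW₁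
  have hsmul {w : E} (hw : ‖w‖ ≤ M) : ‖t • w‖ ≤ M := by
    rw [norm_smul, Real.norm_of_nonneg ht₀.le]
    exact (mul_le_of_le_one_left (norm_nonneg w) ht₁).trans hw
  set K₀ := convexHull ℝ {Q₁, Q₂, Q₃}
  set K₁ := K₀ + segment ℝ 0 (t • W₁)
  set K₂ := K₁ + segment ℝ 0 (t • W₂)
  set K₃ := K₂ + segment ℝ 0 (t • W₃)
  have c₀ : Convex ℝ K₀ := convex_convexHull ℝ _
  have c₁ : Convex ℝ K₁ := c₀.add (convex_segment _ _)
  have c₂ : Convex ℝ K₂ := c₁.add (convex_segment _ _)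
  have c₃ : Convex ℝ K₃ := c₂.add (convex_segment _ _)
  have k₀ : IsCompact K₀ := (Set.toFinite {Q₁, Q₂, Q₃}).isCompact_convexHull ℝ
  have k₁ : IsCompact K₁ := k₀.add (isCompact_segment_zero _)
  have k₂ : IsCompact K₂ := k₁.add (isCompact_segment_zero _)
  have b₀ : K₀ ⊆ closedBall 0 R := by
    refine convexHull_min ?_ (convex_closedBall 0 R)
    rintro x (rfl | rfl | rfl) <;> simpa
  have b₁ : K₁ ⊆ closedBall 0 (R + M) := add_segment_zero_subset_closedBall b₀ (hsmul hW₁)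
  have b₂ : K₂ ⊆ closedBall 0 (R + M + M) := add_segment_zero_subset_closedBall b₁ (hsmul hW₂)
  have hmono {r : ℝ} (hr : r ≤ R + 4 * M) :
      ENNReal.ofReal t * μ (closedBall 0 r) ≤ ENNReal.ofReal t * μ (closedBall 0 (R + 4 * M)) := by
    gcongr
  have m₁ := (c₀.measure_sweep_diff_le μ k₀ b₀ hW₁ ht₀ ht₁).trans (hmono (by linarith))
  have m₂ := (c₁.measure_sweep_diff_le μ k₁ b₁ hW₂ ht₀ ht₁).trans (hmono (by linarith))
  have m₃ := (c₂.measure_sweep_diff_le μ k₂ b₂ hW₃ ht₀ ht₁).trans (hmono (by linarith))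
  have s₁ : K₀ ⊆ K₁ := subset_add_segment_zero _ _
  have s₂ : K₁ ⊆ K₂ := subset_add_segment_zero _ _
  have s₃ : K₂ ⊆ K₃ := subset_add_segment_zero _ _
  have hsub : convexHull ℝ {Q₁ + t • W₁, Q₂ + t • W₂, Q₃ + t • W₃} ⊆ K₃ := by
    refine convexHull_min ?_ c₃
    rintro x (rfl | rfl | rfl)
    · exact s₃ (s₂ (Set.add_mem_add (subset_convexHull ℝ _ (by simp)) (right_mem_segment ℝ _ _)))
    · exact s₃ (Set.add_mem_add (s₁ (subset_convexHull ℝ _ (by simp))) (right_mem_segment ℝ _ _))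
    · exact Set.add_mem_add (s₂ (s₁ (subset_convexHull ℝ _ (by simp)))) (right_mem_segment ℝ _ _)
  calc μ (convexHull ℝ {Q₁ + t • W₁, Q₂ + t • W₂, Q₃ + t • W₃} \ K₀)
      ≤ μ (K₁ \ K₀ ∪ K₂ \ K₁ ∪ K₃ \ K₂) := by
        refine measure_mono fun x hx => ?_
        have := hsub hx.1
        have := hx.2
        simp only [Set.mem_union, Set.mem_sdiff]
        tauto
    _ ≤ μ (K₁ \ K₀) + μ (K₂ \ K₁) + μ (K₃ \ K₂) :=
        (measure_union_le _ _).trans (by gcongr; exact measure_union_le _ _)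
    _ ≤ _ := by
        refine (add_le_add (add_le_add m₁ m₂) m₃).trans_eq ?_
        ring

end ConvexSweep

/-- Area bound |T^t Δ T^0| ≤ Ct for affinely moved triangles (Proposition 3.4). -/
theorem stmt_7 (P₁ P₂ P₃ V₁ V₂ V₃ : EuclideanSpace ℝ (Fin 2))
    (T : ℝ → Set (EuclideanSpace ℝ (Fin 2)))
    (hT : ∀ t, T t = convexHull ℝ {P₁ + t • V₁, P₂ + t • V₂, P₃ + t • V₃}) :
    ∃ C > 0, ∀ t ∈ Set.Icc (0 : ℝ) 1,
      volume (symmDiff (T 0) (T t)) ≤ ENNReal.ofReal (C * t) := by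
  set M := ‖V₁‖ + ‖V₂‖ + ‖V₃‖
  set R := ‖P₁‖ + ‖P₂‖ + ‖P₃‖ + M
  have p₁ := norm_nonneg P₁
  have p₂ := norm_nonneg P₂
  have p₃ := norm_nonneg P₃
  have hV₁ : ‖V₁‖ ≤ M := by linarith [norm_nonneg V₂, norm_nonneg V₃]
  have hV₂ : ‖V₂‖ ≤ M := by linarith [norm_nonneg V₁, norm_nonneg V₃]
  have hV₃ : ‖V₃‖ ≤ M := by linarith [norm_nonneg V₁, norm_nonneg V₂]
  have hM : 0 ≤ M := (norm_nonneg _).trans hV₁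
  set B := volume (Metric.closedBall (0 : EuclideanSpace ℝ (Fin 2)) (R + 4 * M))
  have hB : B ≠ ⊤ := measure_closedBall_lt_top.ne
  refine ⟨6 * B.toReal + 1, by positivity, ?_⟩
  rintro t ⟨ht₀, ht₁⟩
  rcases ht₀.eq_or_lt with rfl | ht₀
  · simp
  have hmove {P V : EuclideanSpace ℝ (Fin 2)} (hV : ‖V‖ ≤ M) : ‖P + t • V‖ ≤ ‖P‖ + M := by
    refine (norm_add_le _ _).trans ?_
    rw [norm_smul, Real.norm_of_nonneg ht₀.le]
    gcongr
    exact (mul_le_of_le_one_left (norm_nonneg V) ht₁).trans hV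
  have hT₀ : T 0 = convexHull ℝ {P₁, P₂, P₃} := by simp [hT]
  have hout : volume (T t \ T 0) ≤ 3 * (ENNReal.ofReal t * B) := by
    rw [hT₀, hT t]
    exact measure_convexHull_triple_diff_le volume (by linarith) (by linarith) (by linarith)
      hV₁ hV₂ hV₃ ht₀ ht₁
  have hin : volume (T 0 \ T t) ≤ 3 * (ENNReal.ofReal t * B) := by
    have h := measure_convexHull_triple_diff_le volume
      (Q₁ := P₁ + t • V₁) (Q₂ := P₂ + t • V₂) (Q₃ := P₃ + t • V₃)
      (W₁ := -V₁) (W₂ := -V₂) (W₃ := -V₃) (R := R) (M := M)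
      ((hmove hV₁).trans (by linarith)) ((hmove hV₂).trans (by linarith))
      ((hmove hV₃).trans (by linarith)) (by rwa [norm_neg]) (by rwa [norm_neg])
      (by rwa [norm_neg]) ht₀ ht₁
    simp only [smul_neg, add_neg_cancel_right] at h
    rwa [hT₀, hT t]
  calc volume (symmDiff (T 0) (T t))
      ≤ volume (T 0 \ T t) + volume (T t \ T 0) := measure_union_le _ _
    _ ≤ 3 * (ENNReal.ofReal t * B) + 3 * (ENNReal.ofReal t * B) := add_le_add hin hout
    _ = ENNReal.ofReal (6 * B.toReal * t) := by
        rw [ENNReal.ofReal_mul (by positivity), ENNReal.ofReal_mul (by positivity),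
          ENNReal.ofReal_toReal hB, ENNReal.ofReal_ofNat]
        ring
    _ ≤ ENNReal.ofReal ((6 * B.toReal + 1) * t) := by
        gcongr
        linarith
end

section
/- Let P₁, P₂, P₃ ∈ ℝ² be affinely independent, and let W₁, W₂, W₃, V₁, V₂, V₃ ∈ ℝ². Then there exist t₀ > 0 and C > 0 such that for every t ∈ [0, t₀]: the points P₁ + tW₁, P₂ + tW₂, P₃ + tW₃ are affinely independent, and the unique affine maps Φ_t : ℝ² → ℝ² with Φ_t(Pᵢ + tWᵢ) = Vᵢ (i = 1,2,3) satisfy ‖Φ_t(x) − Φ₀(x)‖ ≤ C·t·(1 + ‖x‖) for all x ∈ ℝ². -/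
/-- An affine map can be prescribed arbitrarily on a finite affine basis. -/
theorem AffineBasis.exists_affineMap_apply_eq {ι E F : Type*} [Fintype ι] [AddCommGroup E]
    [Module ℝ E] [AddCommGroup F] [Module ℝ F] (b : AffineBasis ι ℝ E) (w : ι → F) :
    ∃ f : E →ᵃ[ℝ] F, ∀ i, f (b i) = w i := by
  classical
  refine ⟨(Fintype.linearCombination ℝ w).toAffineMap.comp b.coords, fun i => ?_⟩
  simp [Fintype.linearCombination_apply, b.coord_apply]

theorem AffineMap.norm_apply_le {E F : Type*} [NormedAddCommGroup E] [NormedSpace ℝ E]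
    [FiniteDimensional ℝ E] [NormedAddCommGroup F] [NormedSpace ℝ F] (f : E →ᵃ[ℝ] F) (x : E) :
    ‖f x‖ ≤ (‖f 0‖ + ‖f.linear.toContinuousLinearMap‖) * (1 + ‖x‖) := by
  have h : f x = f.linear.toContinuousLinearMap x + f 0 := congrFun f.decomp x
  have hL := f.linear.toContinuousLinearMap.le_opNorm x
  calc ‖f x‖ ≤ ‖f.linear.toContinuousLinearMap x‖ + ‖f 0‖ := h ▸ norm_add_le _ _
    _ ≤ _ := by
      nlinarith [norm_nonneg (f 0), norm_nonneg x, norm_nonneg f.linear.toContinuousLinearMap,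
        mul_nonneg (norm_nonneg (f 0)) (norm_nonneg x)]

/-- If `‖t • L‖ ≤ 1 / 2`, then `1 + t • L` is injective. -/
theorem ContinuousLinearMap.eq_zero_of_add_smul_eq_zero {E : Type*} [NormedAddCommGroup E]
    [NormedSpace ℝ E] (L : E →L[ℝ] E) {t : ℝ} (ht : 0 ≤ t) (htL : t * ‖L‖ ≤ 1 / 2) {v : E}
    (hv : v + t • L v = 0) : v = 0 := by
  have h : ‖v‖ = t * ‖L v‖ := by
    rw [eq_neg_of_add_eq_zero_left hv, norm_neg, norm_smul, Real.norm_of_nonneg ht,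
      ← eq_neg_of_add_eq_zero_left hv]
  have hL : t * ‖L v‖ ≤ t * (‖L‖ * ‖v‖) := mul_le_mul_of_nonneg_left (L.le_opNorm v) ht
  have hv' := mul_le_mul_of_nonneg_right htL (norm_nonneg v)
  exact norm_le_zero_iff.mp (by linarith)

/-- If `‖t • L‖ ≤ 1 / 2` and `G ∘ (1 + t • L) = A`, then `‖G‖ ≤ 2 * ‖A‖`. -/
theorem ContinuousLinearMap.norm_le_two_mul_norm_of_apply_add_smul {E F : Type*}
    [NormedAddCommGroup E] [NormedSpace ℝ E] [NormedAddCommGroup F] [NormedSpace ℝ F]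
    (L : E →L[ℝ] E) (G A : E →L[ℝ] F) {t : ℝ} (ht : 0 ≤ t) (htL : t * ‖L‖ ≤ 1 / 2)
    (h : ∀ v, G (v + t • L v) = A v) : ‖G‖ ≤ 2 * ‖A‖ := by
  suffices ‖G‖ ≤ ‖A‖ + ‖G‖ / 2 by linarith
  refine G.opNorm_le_bound (by positivity) fun v => ?_
  have hG : G v = A v - t • G (L v) := by
    rw [← h v, map_add, map_smul, add_sub_cancel_right]
  calc ‖G v‖ ≤ ‖A v‖ + t * ‖G (L v)‖ := by
        rw [hG]
        exact (norm_sub_le _ _).trans_eq (by rw [norm_smul, Real.norm_of_nonneg ht])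
    _ ≤ ‖A‖ * ‖v‖ + t * (‖G‖ * (‖L‖ * ‖v‖)) := by
        gcongr
        · exact A.le_opNorm v
        · exact (G.le_opNorm _).trans (by gcongr; exact L.le_opNorm v)
    _ = ‖A‖ * ‖v‖ + t * ‖L‖ * (‖G‖ * ‖v‖) := by ring
    _ ≤ ‖A‖ * ‖v‖ + 1 / 2 * (‖G‖ * ‖v‖) := by gcongr
    _ = (‖A‖ + ‖G‖ / 2) * ‖v‖ := by ring

/-- Affine interpolation depends in a Lipschitz way on a linear perturbation of the nodes. -/
theorem AffineBasis.exists_norm_interpolation_sub_le {ι E F : Type*} [Fintype ι]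
    [NormedAddCommGroup E] [NormedSpace ℝ E] [FiniteDimensional ℝ E] [NormedAddCommGroup F]
    [NormedSpace ℝ F] (b : AffineBasis ι ℝ E) (w : ι → E) (v : ι → F) :
    ∃ t₀ > 0, ∃ C > 0, ∀ t ∈ Set.Icc (0 : ℝ) t₀,
      AffineIndependent ℝ (fun i => b i + t • w i) ∧
      ∀ Φt Φ0 : E →ᵃ[ℝ] F, (∀ i, Φt (b i + t • w i) = v i) → (∀ i, Φ0 (b i) = v i) →
        ∀ x, ‖Φt x - Φ0 x‖ ≤ C * t * (1 + ‖x‖) := by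
  obtain ⟨f, hf⟩ := b.exists_affineMap_apply_eq w
  obtain ⟨Ψ, hΨ⟩ := b.exists_affineMap_apply_eq v
  set L := f.linear.toContinuousLinearMap with hL
  set A := Ψ.linear.toContinuousLinearMap with hA
  refine ⟨1 / (2 * (‖L‖ + 1)), by positivity, 2 * ‖A‖ * (‖f 0‖ + ‖L‖) + 1, by positivity, ?_⟩
  rintro t ⟨ht, ht'⟩
  have htL : t * ‖L‖ ≤ 1 / 2 := by
    rw [le_div_iff₀ (by positivity)] at ht'
    linarith
  refine ⟨?_, fun Φt Φ0 hΦt hΦ0 x => ?_⟩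
  · have key := b.ind.map' (AffineMap.id ℝ E + t • f) (by
      refine (AffineMap.linear_injective_iff _).mp
        ((injective_iff_map_eq_zero _).mpr fun u hu => ?_)
      exact L.eq_zero_of_add_smul_eq_zero ht htL hu)
    convert key using 1
    funext i
    simp [hf]
  · have hΨ0 : Φ0 = Ψ := AffineMap.ext_on b.tot (by
      rintro _ ⟨i, rfl⟩
      rw [hΦ0, hΨ])
    have hcomp : Φt.comp (AffineMap.id ℝ E + t • f) = Ψ := AffineMap.ext_on b.tot (by
      rintro _ ⟨i, rfl⟩
      simp [hf, hΦt, hΨ])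
    have hG := L.norm_le_two_mul_norm_of_apply_add_smul Φt.linear.toContinuousLinearMap A ht htL
      fun u => by
        simp only [hA, ← hcomp]
        rfl
    have hx : Φt x - Φ0 x = -(t • Φt.linear.toContinuousLinearMap (f x)) := by
      have h : Φ0 x = Φt (t • f x +ᵥ x) := by
        rw [hΨ0, ← hcomp, vadd_eq_add, add_comm]
        rfl
      rw [h, Φt.map_vadd]
      simp
    calc ‖Φt x - Φ0 x‖ = t * ‖Φt.linear.toContinuousLinearMap (f x)‖ := by
          rw [hx, norm_neg, norm_smul, Real.norm_of_nonneg ht]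
      _ ≤ t * (2 * ‖A‖ * ((‖f 0‖ + ‖L‖) * (1 + ‖x‖))) := by
          gcongr
          exact (ContinuousLinearMap.le_opNorm _ _).trans
            (mul_le_mul hG (f.norm_apply_le x) (norm_nonneg _) (by positivity))
      _ = 2 * ‖A‖ * (‖f 0‖ + ‖L‖) * t * (1 + ‖x‖) := by ring
      _ ≤ (2 * ‖A‖ * (‖f 0‖ + ‖L‖) + 1) * t * (1 + ‖x‖) := by
          gcongr
          linarith


/-- Lipschitz dependence in t of the affine interpolation maps (estimate (4.12), Lemma 4.4). -/
theorem stmt_12 (P₁ P₂ P₃ W₁ W₂ W₃ V₁ V₂ V₃ : EuclideanSpace ℝ (Fin 2))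
    (hP : AffineIndependent ℝ ![P₁, P₂, P₃]) :
    ∃ t₀ > 0, ∃ C > 0, ∀ t ∈ Set.Icc (0 : ℝ) t₀,
      AffineIndependent ℝ ![P₁ + t • W₁, P₂ + t • W₂, P₃ + t • W₃] ∧
      ∀ (Φt Φ0 : EuclideanSpace ℝ (Fin 2) →ᵃ[ℝ] EuclideanSpace ℝ (Fin 2)),
        (Φt (P₁ + t • W₁) = V₁ ∧ Φt (P₂ + t • W₂) = V₂ ∧ Φt (P₃ + t • W₃) = V₃) →
        (Φ0 P₁ = V₁ ∧ Φ0 P₂ = V₂ ∧ Φ0 P₃ = V₃) →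
        ∀ x, ‖Φt x - Φ0 x‖ ≤ C * t * (1 + ‖x‖) := by
  let b : AffineBasis (Fin 3) ℝ (EuclideanSpace ℝ (Fin 2)) :=
    ⟨![P₁, P₂, P₃], hP, hP.affineSpan_eq_top_iff_card_eq_finrank_add_one.mpr (by simp)⟩
  have hb : ⇑b = ![P₁, P₂, P₃] := rfl
  obtain ⟨t₀, ht₀, C, hC, h⟩ :=
    b.exists_norm_interpolation_sub_le ![W₁, W₂, W₃] ![V₁, V₂, V₃]
  refine ⟨t₀, ht₀, C, hC, fun t ht => ⟨?_, fun Φt Φ0 hΦt hΦ0 => (h t ht).2 Φt Φ0 ?_ ?_⟩⟩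
  · have hp : ![P₁ + t • W₁, P₂ + t • W₂, P₃ + t • W₃] =
        fun i => b i + t • ![W₁, W₂, W₃] i := by
      funext i
      fin_cases i <;> simp [hb]
    rw [hp]
    exact (h t ht).1
  · simpa [Fin.forall_fin_succ, hb] using hΦt
  · simpa [Fin.forall_fin_succ, hb] using hΦ0
end
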